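/- For every λ ∈ ℂ and Y₀ > 0, the operator L(g) = 2y² g'' - λg is surjective on the space P of smooth functions g: ℝ → ℂ supported in {y > Y₀} such that there exists R with, for every j ≥ 0, a constant C_j making |g^{(j)}(y)| ≤ C_j (2+|y|)^{R-j} for all y. -/

import Mathlib

open Real

/-- Membership in the space `P_{≥ Y₀}`: smooth functions `g : ℝ → ℂ` vanishing
for `y ≤ Y₀` all of whose derivatives satisfy the uniform polynomial bounds
`|g⁽ʲ⁾(y)| ≤ C_j (2 + |y|)^(R - j)` for a single exponent `R`. -/
def MemP (Y₀ : ℝ) (g : ℝ → ℂ) : Prop :=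
  ContDiff ℝ (⊤ : ℕ∞) g ∧ (∀ y : ℝ, y ≤ Y₀ → g y = 0) ∧
    ∃ R : ℝ, ∀ j : ℕ, ∃ C : ℝ, ∀ y : ℝ,
      ‖iteratedDeriv j g y‖ ≤ C * (2 + |y|) ^ (R - (j : ℝ))

/-- The complex power `y ^ q` of a positive real `y`, written as an exponential. -/
noncomputable def expLog (q : ℂ) (y : ℝ) : ℂ :=
  Complex.exp (q * (Real.log y : ℂ))

lemma hasDerivAt_expLog (q : ℂ) {y : ℝ} (hy : 0 < y) :
    HasDerivAt (expLog q) (expLog q y * (q * ((y⁻¹ : ℝ) : ℂ))) y :=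
  (((Real.hasDerivAt_log hy.ne').ofReal_comp).const_mul q).cexp

lemma contDiffAt_expLog (q : ℂ) {y : ℝ} (hy : 0 < y) {n : WithTop ℕ∞} :
    ContDiffAt ℝ n (expLog q) y :=
  (contDiffAt_const.mul
    (Complex.ofRealCLM.contDiff.contDiffAt.comp y (Real.contDiffAt_log.2 hy.ne'))).cexp

lemma norm_expLog (q : ℂ) {y : ℝ} (hy : 0 < y) : ‖expLog q y‖ = y ^ q.re := by
  rw [expLog, Complex.norm_exp, Real.rpow_def_of_pos hy]
  congr 1
  simp [mul_comm]

lemma expLog_add (p q : ℂ) (y : ℝ) : expLog (p + q) y = expLog p y * expLog q y := by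
  rw [expLog, add_mul, Complex.exp_add, expLog, expLog]

lemma expLog_neg_one {y : ℝ} (hy : 0 < y) : expLog (-1) y = (y : ℂ)⁻¹ := by
  rw [expLog, neg_one_mul, Complex.exp_neg, ← Complex.ofReal_exp, Real.exp_log hy]

/-- Polynomial growth on the whole line. -/
def PolyBounded (g : ℝ → ℂ) : Prop :=
  ∃ C : ℝ, ∃ N : ℕ, ∀ y : ℝ, ‖g y‖ ≤ C * (2 + |y|) ^ N

lemma eventuallyEq_zero_of_lt {Y₀ y : ℝ} {g : ℝ → ℂ} (hg : ∀ y ≤ Y₀, g y = 0) (hy : y < Y₀) :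
    g =ᶠ[nhds y] fun _ => 0 := by
  filter_upwards [Iio_mem_nhds hy] with t ht using hg t (le_of_lt ht)

lemma contDiff_mul_expLog {Y₀ : ℝ} (hY₀ : 0 < Y₀) {g : ℝ → ℂ} {n : WithTop ℕ∞}
    (hs : ContDiff ℝ n g) (hg : ∀ y ≤ Y₀, g y = 0) (q : ℂ) :
    ContDiff ℝ n fun y => g y * expLog q y := by
  rw [contDiff_iff_contDiffAt]
  intro y
  rcases lt_or_ge 0 y with hy | hy
  · exact hs.contDiffAt.mul (contDiffAt_expLog q hy)
  · have hz : ∀ t ≤ Y₀, g t * expLog q t = 0 := fun t ht => by rw [hg t ht, zero_mul]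
    exact contDiffAt_const.congr_of_eventuallyEq
      (eventuallyEq_zero_of_lt hz (hy.trans_lt hY₀))

lemma rpow_le_const_mul_pow {Y₀ : ℝ} (hY₀ : 0 < Y₀) (a : ℝ) :
    ∃ K : ℝ, ∃ M : ℕ, 0 ≤ K ∧ ∀ y, Y₀ ≤ y → y ^ a ≤ K * (2 + |y|) ^ M := by
  rcases le_total 0 a with ha | ha
  · refine ⟨1, ⌈a⌉₊, zero_le_one, fun y hy => ?_⟩
    have h0 : 0 ≤ y := hY₀.le.trans hy
    rw [one_mul, abs_of_nonneg h0, ← Real.rpow_natCast]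
    exact (Real.rpow_le_rpow h0 (by linarith) ha).trans
      (Real.rpow_le_rpow_of_exponent_le (by linarith) (Nat.le_ceil a))
  · refine ⟨Y₀ ^ a, 0, Real.rpow_nonneg hY₀.le a, fun y hy => ?_⟩
    simpa using Real.rpow_le_rpow_of_nonpos hY₀ hy ha

lemma PolyBounded.mul_expLog {Y₀ : ℝ} (hY₀ : 0 < Y₀) {g : ℝ → ℂ}
    (hb : PolyBounded g) (hg : ∀ y ≤ Y₀, g y = 0) (q : ℂ) :
    PolyBounded fun y => g y * expLog q y := by
  obtain ⟨C, N, hC⟩ := hb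
  obtain ⟨K, M, hK, hM⟩ := rpow_le_const_mul_pow hY₀ q.re
  have hC0 : 0 ≤ C := by
    have h := (norm_nonneg _).trans (hC 0)
    exact nonneg_of_mul_nonneg_left h (by positivity)
  refine ⟨C * K, N + M, fun y => ?_⟩
  rcases le_total y Y₀ with hy | hy
  · simp only [hg y hy, zero_mul, norm_zero]
    positivity
  · rw [norm_mul, norm_expLog q (hY₀.trans_le hy)]
    calc ‖g y‖ * y ^ q.re ≤ (C * (2 + |y|) ^ N) * (K * (2 + |y|) ^ M) :=
          mul_le_mul (hC y) (hM y hy) (Real.rpow_nonneg (hY₀.le.trans hy) _) (by positivity)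
      _ = C * K * (2 + |y|) ^ (N + M) := by ring

lemma integral_eq_zero_of_le {Y₀ y : ℝ} {h : ℝ → ℂ} (hh : ∀ y ≤ Y₀, h y = 0) (hy : y ≤ Y₀) :
    ∫ t in Y₀..y, h t = 0 := by
  rw [intervalIntegral.integral_congr (g := fun _ => (0 : ℂ))]
  · simp
  · intro t ht
    rw [Set.uIcc_of_ge hy] at ht
    exact hh t ht.2

lemma PolyBounded.integral {Y₀ : ℝ} (hY₀ : 0 < Y₀) {h : ℝ → ℂ}
    (hb : PolyBounded h) (hh : ∀ y ≤ Y₀, h y = 0) :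
    PolyBounded fun y => ∫ t in Y₀..y, h t := by
  obtain ⟨C, N, hC⟩ := hb
  have hC0 : 0 ≤ C := by
    have h := (norm_nonneg _).trans (hC 0)
    exact nonneg_of_mul_nonneg_left h (by positivity)
  refine ⟨C, N + 1, fun y => ?_⟩
  rcases le_total y Y₀ with hy | hy
  · simp only [integral_eq_zero_of_le hh hy, norm_zero]
    positivity
  · have hle : ‖∫ t in Y₀..y, h t‖ ≤ C * (2 + |y|) ^ N * |y - Y₀| := by
      refine intervalIntegral.norm_integral_le_of_norm_le_const fun t ht => ?_
      rw [Set.uIoc_of_le hy] at ht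
      refine (hC t).trans ?_
      have : |t| ≤ |y| := abs_le_abs_of_nonneg (hY₀.le.trans ht.1.le) ht.2
      gcongr
    refine hle.trans ?_
    rw [pow_succ, ← mul_assoc]
    have : |y - Y₀| ≤ 2 + |y| := by
      rw [abs_of_nonneg (sub_nonneg.2 hy), abs_of_nonneg (hY₀.le.trans hy)]
      linarith
    gcongr

lemma MemP.polyBounded {Y₀ : ℝ} {f : ℝ → ℂ} (hf : MemP Y₀ f) : PolyBounded f := by
  obtain ⟨-, -, R, hR⟩ := hf
  obtain ⟨C, hC⟩ := hR 0
  refine ⟨|C|, ⌈R⌉₊, fun y => ?_⟩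
  have h1 : (1 : ℝ) ≤ 2 + |y| := by linarith [abs_nonneg y]
  have h := hC y
  simp only [iteratedDeriv_zero, Nat.cast_zero, sub_zero] at h
  rw [← Real.rpow_natCast]
  exact h.trans (mul_le_mul (le_abs_self C)
    (Real.rpow_le_rpow_of_exponent_le h1 (Nat.le_ceil R)) (by positivity) (abs_nonneg C))

/-- Differentiating `y u' - p u = f` repeatedly. -/
lemma iteratedDeriv_euler {u f : ℝ → ℂ} (hu : ContDiff ℝ (⊤ : ℕ∞) u)
    (hf : ContDiff ℝ (⊤ : ℕ∞) f) {p : ℂ} (h : ∀ y : ℝ, (y : ℂ) * deriv u y - p * u y = f y)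
    (j : ℕ) (y : ℝ) :
    (y : ℂ) * iteratedDeriv (j + 1) u y = (p - j) * iteratedDeriv j u y + iteratedDeriv j f y := by
  have hasDeriv : ∀ {g : ℝ → ℂ}, ContDiff ℝ (⊤ : ℕ∞) g → ∀ (k : ℕ) (x : ℝ),
      HasDerivAt (iteratedDeriv k g) (iteratedDeriv (k + 1) g x) x := by
    intro g hg k x
    rw [iteratedDeriv_succ]
    exact (hg.differentiable_iteratedDeriv k (by exact_mod_cast WithTop.coe_lt_top k)
      x).hasDerivAt
  induction j generalizing y with
  | zero =>
    simp only [zero_add, iteratedDeriv_one, iteratedDeriv_zero, Nat.cast_zero, sub_zero]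
    linear_combination h y
  | succ j ih =>
    have hl := ((hasDerivAt_id y).ofReal_comp).mul (hasDeriv hu (j + 1) y)
    have hr := ((hasDeriv hu j y).const_mul (p - j)).add (hasDeriv hf j y)
    have heq := hl.unique (hr.congr_of_eventuallyEq (Filter.Eventually.of_forall ih))
    simp only [id, Complex.ofReal_one, one_mul] at heq
    push_cast
    linear_combination heq

lemma iteratedDeriv_eq_zero_of_lt {Y₀ y : ℝ} {g : ℝ → ℂ} (hg : ∀ y ≤ Y₀, g y = 0)
    (hy : y < Y₀) (j : ℕ) : iteratedDeriv j g y = 0 := by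
  rw [(eventuallyEq_zero_of_lt hg hy).iteratedDeriv_eq]
  simp

lemma memP_of_euler {Y₀ : ℝ} (hY₀ : 0 < Y₀) {u f : ℝ → ℂ} (hf : MemP Y₀ f)
    (hu : ContDiff ℝ (⊤ : ℕ∞) u) (hu0 : ∀ y ≤ Y₀, u y = 0) (hb : PolyBounded u) {p : ℂ}
    (h : ∀ y : ℝ, (y : ℂ) * deriv u y - p * u y = f y) : MemP Y₀ u := by
  obtain ⟨hfs, -, R, hR⟩ := hf
  obtain ⟨C₀, N, hC₀⟩ := hb
  refine ⟨hu, hu0, max R N, fun j => ?_⟩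
  suffices ∃ C, 0 ≤ C ∧ ∀ y : ℝ, ‖iteratedDeriv j u y‖ ≤ C * (2 + |y|) ^ (max R N - (j : ℝ)) by
    obtain ⟨C, -, hC⟩ := this
    exact ⟨C, hC⟩
  induction j with
  | zero =>
    refine ⟨|C₀|, abs_nonneg _, fun y => ?_⟩
    have h1 : (1 : ℝ) ≤ 2 + |y| := by linarith [abs_nonneg y]
    rw [iteratedDeriv_zero, Nat.cast_zero, sub_zero]
    refine (hC₀ y).trans ?_
    rw [← Real.rpow_natCast]
    exact mul_le_mul (le_abs_self _)
      (Real.rpow_le_rpow_of_exponent_le h1 (le_max_right _ _)) (by positivity) (abs_nonneg _)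
  | succ j ih =>
    obtain ⟨C, hC0, hC⟩ := ih
    obtain ⟨D, hD⟩ := hR j
    have hK : 0 ≤ 1 + 2 / Y₀ := by positivity
    refine ⟨(1 + 2 / Y₀) * (‖p - j‖ * C + |D|), by positivity, fun y => ?_⟩
    rcases lt_or_ge y Y₀ with hy | hy
    · rw [iteratedDeriv_eq_zero_of_lt hu0 hy, norm_zero]
      positivity
    · have hy0 : 0 < y := hY₀.trans_le hy
      have h2 : 0 < 2 + |y| := by positivity
      have h1 : (1 : ℝ) ≤ 2 + |y| := by linarith [abs_nonneg y]
      have hlin : 2 + |y| ≤ (1 + 2 / Y₀) * y := by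
        have : 2 ≤ 2 / Y₀ * y := by
          rw [div_mul_eq_mul_div, le_div_iff₀ hY₀]
          linarith
        rw [abs_of_pos hy0]
        linarith
      have hfy : ‖iteratedDeriv j f y‖ ≤ |D| * (2 + |y|) ^ (max R N - (j : ℝ)) :=
        (hD y).trans (mul_le_mul (le_abs_self D)
          (Real.rpow_le_rpow_of_exponent_le h1 (sub_le_sub_right (le_max_left _ _) _))
          (by positivity) (abs_nonneg D))
      have hmul : y * ‖iteratedDeriv (j + 1) u y‖ ≤
          (‖p - j‖ * C + |D|) * (2 + |y|) ^ (max R N - (j : ℝ)) := by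
        calc y * ‖iteratedDeriv (j + 1) u y‖ = ‖(y : ℂ) * iteratedDeriv (j + 1) u y‖ := by
              rw [norm_mul, Complex.norm_of_nonneg hy0.le]
          _ ≤ ‖p - j‖ * ‖iteratedDeriv j u y‖ + ‖iteratedDeriv j f y‖ := by
              rw [iteratedDeriv_euler hu hfs h, ← norm_mul]
              exact norm_add_le _ _
          _ ≤ ‖p - j‖ * (C * (2 + |y|) ^ (max R N - (j : ℝ))) +
                |D| * (2 + |y|) ^ (max R N - (j : ℝ)) := by
              gcongr
              exact hC y
          _ = _ := by ring
      have hexp : (2 + |y|) ^ (max R N - ((j + 1 : ℕ) : ℝ)) =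
          (2 + |y|) ^ (max R N - (j : ℝ)) / (2 + |y|) := by
        rw [Nat.cast_succ, ← sub_sub, Real.rpow_sub_one h2.ne']
      rw [hexp, ← mul_div_assoc, le_div_iff₀ h2]
      calc ‖iteratedDeriv (j + 1) u y‖ * (2 + |y|)
          ≤ ‖iteratedDeriv (j + 1) u y‖ * ((1 + 2 / Y₀) * y) := by gcongr
        _ = (1 + 2 / Y₀) * (y * ‖iteratedDeriv (j + 1) u y‖) := by ring
        _ ≤ (1 + 2 / Y₀) *
            ((‖p - j‖ * C + |D|) * (2 + |y|) ^ (max R N - (j : ℝ))) := by gcongr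
        _ = _ := by ring

/-- The first-order Euler operator `u ↦ y u' - p u` is surjective on `P_{≥ Y₀}`. -/
lemma euler_operator_surjective {Y₀ : ℝ} (hY₀ : 0 < Y₀) (p : ℂ) {f : ℝ → ℂ} (hf : MemP Y₀ f) :
    ∃ u : ℝ → ℂ, MemP Y₀ u ∧ ∀ y : ℝ, (y : ℂ) * deriv u y - p * u y = f y := by
  obtain ⟨hfs, hf0, -⟩ := id hf
  set h : ℝ → ℂ := fun y => f y * expLog (-p + -1) y with hh
  set H : ℝ → ℂ := fun y => ∫ t in Y₀..y, h t
  set u : ℝ → ℂ := fun y => H y * expLog p y with hu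
  have hs : ContDiff ℝ (⊤ : ℕ∞) h := contDiff_mul_expLog hY₀ hfs hf0 _
  have hz : ∀ y ≤ Y₀, h y = 0 := fun y hy => by rw [hh]; simp [hf0 y hy]
  have hd : ∀ y, HasDerivAt H (h y) y := fun y =>
    intervalIntegral.integral_hasDerivAt_right (hs.continuous.intervalIntegrable _ _)
      (hs.continuous.stronglyMeasurableAtFilter _ _) hs.continuous.continuousAt
  have hHs : ContDiff ℝ (⊤ : ℕ∞) H := by
    rw [contDiff_infty_iff_deriv, funext fun y => (hd y).deriv]
    exact ⟨fun y => (hd y).differentiableAt, hs⟩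
  have hHz : ∀ y ≤ Y₀, H y = 0 := fun y hy => integral_eq_zero_of_le hz hy
  have hus : ContDiff ℝ (⊤ : ℕ∞) u := contDiff_mul_expLog hY₀ hHs hHz p
  have huz : ∀ y ≤ Y₀, u y = 0 := fun y hy => by rw [hu]; simp [hHz y hy]
  have hub : PolyBounded u :=
    ((hf.polyBounded.mul_expLog hY₀ hf0 _).integral hY₀ hz).mul_expLog hY₀ hHz p
  have heq : ∀ y : ℝ, (y : ℂ) * deriv u y - p * u y = f y := by
    intro y
    rcases lt_or_ge 0 y with hy | hy
    · have hy' : (y : ℂ) ≠ 0 := Complex.ofReal_ne_zero.2 hy.ne'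
      have hinv : expLog (-p) y * expLog p y = 1 := by
        rw [← expLog_add]
        simp [expLog]
      have hdu : deriv u y = _ := ((hd y).mul (hasDerivAt_expLog p hy)).deriv
      rw [hdu]
      simp only [hh, hu, expLog_add, expLog_neg_one hy, Complex.ofReal_inv]
      field_simp
      linear_combination f y * hinv
    · have hlt := hy.trans_lt hY₀
      rw [(eventuallyEq_zero_of_lt huz hlt).deriv_eq, huz y hlt.le, hf0 y hlt.le]
      simp
  exact ⟨u, memP_of_euler hY₀ hf hus huz hub heq, heq⟩

lemma MemP.const_mul {Y₀ : ℝ} {f : ℝ → ℂ} (hf : MemP Y₀ f) (c : ℂ) :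
    MemP Y₀ fun y => c * f y := by
  obtain ⟨hs, hz, R, hR⟩ := hf
  refine ⟨contDiff_const.mul hs, fun y hy => by simp [hz y hy], R, fun j => ?_⟩
  obtain ⟨C, hC⟩ := hR j
  refine ⟨‖c‖ * C, fun y => ?_⟩
  rw [iteratedDeriv_const_mul_field, norm_mul, mul_assoc]
  gcongr
  exact hC y

/-- For every `λ ∈ ℂ` and `Y₀ > 0`, the operator
`L g = 2 y² g'' - λ g` is surjective on the space `P_{≥ Y₀}`. -/
theorem casimir_type_operator_surjective_on_P
    (lam : ℂ) (Y₀ : ℝ) (hY₀ : 0 < Y₀) :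
    ∀ f : ℝ → ℂ, MemP Y₀ f →
      ∃ g : ℝ → ℂ, MemP Y₀ g ∧
        ∀ y : ℝ, 2 * (y : ℂ) ^ 2 * deriv (deriv g) y - lam * g y = f y := by
  intro f hf
  -- `L = 2 (y d/dy - p₁) (y d/dy - p₂)` with `p₁, p₂ = 1/2 ± s`
  obtain ⟨s, hs⟩ := IsAlgClosed.exists_eq_mul_self (1 / 4 + lam / 2)
  obtain ⟨v, hv, hvf⟩ := euler_operator_surjective hY₀ (1 / 2 + s) (hf.const_mul (1 / 2))
  obtain ⟨g, hg, hgv⟩ := euler_operator_surjective hY₀ (1 / 2 - s) hv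
  refine ⟨g, hg, fun y => ?_⟩
  have h₁ := iteratedDeriv_euler hg.1 hv.1 hgv 1 y
  simp only [iteratedDeriv_succ, iteratedDeriv_zero, Nat.cast_one] at h₁
  linear_combination 2 * y * h₁ + 2 * hvf y - 2 * (1 / 2 + s) * hgv y - 2 * g y * hs
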